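/- Suppose a user has n⁺ positive items and n⁻ negative items with pairwise distinct scores, and let K be an integer with K < n⁺ and K < n⁻. Then Precision@K ≥ (1/K)·⌊K − √(K² − n⁺·n⁻·LLPAUC(K/n⁺, K/n⁻))⌋, where ⌊·⌋ is the floor function and √ is the real square root. -/

import Mathlib

open Finset

open scoped Classical

noncomputable section

/-- The `K` highest-scoring items under the score function `f`: those items
with fewer than `K` items scoring strictly higher (with pairwise distinct
scores these are exactly the top `K` items, provided `K ≤ card`). -/
def topK {α : Type*} [Fintype α] (K : ℕ) (f : α → ℝ) : Finset α :=
  Finset.univ.filter fun a => (Finset.univ.filter fun b => f a < f b).card < K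

/-- Empirical LLPAUC at `(α, β) = (K/n⁺, K/n⁻)`: the fraction (over all
`n⁺ · n⁻` pairs) of pairs `(i, j)` where `i` is one of the `K` highest-scoring
positive items, `j` is one of the `K` highest-scoring negative items, and
`i`'s score exceeds `j`'s score. -/
def llpauc (np nn K : ℕ) (p : Fin np → ℝ) (q : Fin nn → ℝ) : ℝ :=
  (((topK K p ×ˢ topK K q).filter fun ij => q ij.2 < p ij.1).card : ℝ) /
    ((np : ℝ) * (nn : ℝ))

/-- Empirical OPAUC at `β = K/n⁻`: the fraction (over all `n⁺ · n⁻` pairs) of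
pairs `(i, j)` where `i` is any positive item, `j` is one of the `K`
highest-scoring negative items, and `i`'s score exceeds `j`'s score. -/
def opauc (np nn K : ℕ) (p : Fin np → ℝ) (q : Fin nn → ℝ) : ℝ :=
  (((Finset.univ ×ˢ topK K q).filter fun ij : Fin np × Fin nn =>
      q ij.2 < p ij.1).card : ℝ) / ((np : ℝ) * (nn : ℝ))

/-- The number of positive items among the `K` highest-scoring items overall
(positives scored by `p`, negatives scored by `q`). -/
def hitNum (np nn K : ℕ) (p : Fin np → ℝ) (q : Fin nn → ℝ) : ℕ :=
  (Finset.univ.filter fun i : Fin np =>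
    (Finset.univ.filter fun x : Fin np ⊕ Fin nn =>
      p i < Sum.elim p q x).card < K).card

/-- Recall@K: the number of positive items among the `K` highest-scoring items
overall, divided by the number `n⁺` of positive items. -/
def recallK (np nn K : ℕ) (p : Fin np → ℝ) (q : Fin nn → ℝ) : ℝ :=
  (hitNum np nn K p q : ℝ) / (np : ℝ)

/-- Precision@K: the number of positive items among the `K` highest-scoring
items overall, divided by `K`. -/
def precisionK (np nn K : ℕ) (p : Fin np → ℝ) (q : Fin nn → ℝ) : ℝ :=
  (hitNum np nn K p q : ℝ) / (K : ℝ)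

/-- With pairwise distinct scores, `topK K f` has exactly `K` elements once `K ≤ card`. -/
theorem card_topK {α : Type*} [Fintype α] {K : ℕ} {f : α → ℝ} (hf : Function.Injective f)
    (hK : K ≤ Fintype.card α) : (topK K f).card = K := by
  set r : α → ℕ := fun a => (Finset.univ.filter fun b => f a < f b).card with hr
  have hlt : ∀ a b, f a < f b → r b < r a := fun a b hab =>
    Finset.card_lt_card <| Finset.ssubset_iff_subset_ne.2
      ⟨fun c hc => by
        simp only [Finset.mem_filter, Finset.mem_univ, true_and] at hc ⊢
        exact hab.trans hc,
      fun h => by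
        have hb : b ∈ Finset.univ.filter fun c => f a < f c := by simpa using hab
        rw [← h] at hb
        simp at hb⟩
  have hinj : Function.Injective r := fun a b hab => by
    rcases lt_trichotomy (f a) (f b) with h | h | h
    · exact absurd hab (hlt a b h).ne'
    · exact hf h
    · exact absurd hab (hlt b a h).ne
  have hbound : ∀ a, r a < Fintype.card α := fun a =>
    Finset.card_lt_univ_of_notMem (x := a) (by simp)
  have himage : Finset.univ.image r = Finset.range (Fintype.card α) := by
    refine Finset.eq_of_subset_of_card_le ?_ ?_
    · intro n hn
      obtain ⟨a, -, rfl⟩ := Finset.mem_image.1 hn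
      exact Finset.mem_range.2 (hbound a)
    · rw [Finset.card_image_of_injective _ hinj, Finset.card_range, Finset.card_univ]
  have htop : (topK K f).image r = Finset.range K := by
    ext n
    simp only [Finset.mem_image, Finset.mem_range]
    constructor
    · rintro ⟨a, ha, rfl⟩
      exact (Finset.mem_filter.1 ha).2
    · intro hn
      have hmem : n ∈ Finset.univ.image r := by
        rw [himage]
        exact Finset.mem_range.2 (hn.trans_le hK)
      obtain ⟨a, -, rfl⟩ := Finset.mem_image.1 hmem
      exact ⟨a, Finset.mem_filter.2 ⟨Finset.mem_univ a, hn⟩, rfl⟩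
  rw [← Finset.card_image_of_injective (topK K f) hinj, htop, Finset.card_range]

/-- An item that is among the top `K` of a larger collection is among the top `K` of any
subcollection containing it. -/
theorem mem_topK_comp {α β : Type*} [Fintype α] [Fintype β] {K : ℕ} {f : β → ℝ} {g : α → β}
    (hg : Function.Injective g) {a : α} (ha : g a ∈ topK K f) : a ∈ topK K (f ∘ g) := by
  refine Finset.mem_filter.2 ⟨Finset.mem_univ a, lt_of_le_of_lt ?_ (Finset.mem_filter.1 ha).2⟩
  refine Finset.card_le_card_of_injOn g (fun b hb => ?_) hg.injOn
  simpa using hb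

/-- `topK` is an upper set for the score. -/
theorem mem_topK_of_le {α : Type*} [Fintype α] {K : ℕ} {f : α → ℝ} {a b : α}
    (ha : a ∈ topK K f) (hab : f a ≤ f b) : b ∈ topK K f := by
  refine Finset.mem_filter.2 ⟨Finset.mem_univ b, lt_of_le_of_lt ?_ (Finset.mem_filter.1 ha).2⟩
  refine Finset.card_le_card fun c hc => ?_
  simp only [Finset.mem_filter, Finset.mem_univ, true_and] at hc ⊢
  exact hab.trans_lt hc

/-- The number of correctly ordered pairs among the top `K` positives and the top `K` negatives
is at most `K² - (K - hitNum)²`. -/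
theorem card_ordered_pairs_add_sq_le {np nn K : ℕ} {p : Fin np → ℝ} {q : Fin nn → ℝ}
    (hinj : Function.Injective (Sum.elim p q)) (hKp : K ≤ np) (hKn : K ≤ nn) :
    hitNum np nn K p q ≤ K ∧
      ((topK K p ×ˢ topK K q).filter fun ij => q ij.2 < p ij.1).card +
        (K - hitNum np nn K p q) ^ 2 ≤ K ^ 2 := by
  set T := topK K (Sum.elim p q) with hT
  set H := Finset.univ.filter fun i : Fin np => Sum.inl i ∈ T with hH
  set G := Finset.univ.filter fun j : Fin nn => Sum.inr j ∈ T with hG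
  have hhit : hitNum np nn K p q = H.card := by
    simp only [hitNum, hH, hT, topK, Finset.mem_filter, Finset.mem_univ, true_and,
      Sum.elim_inl]
    congr!
  have hA : (topK K p).card = K :=
    card_topK (fun a b h => Sum.inl_injective (hinj (by simpa using h))) (by simpa using hKp)
  have hB : (topK K q).card = K :=
    card_topK (fun a b h => Sum.inr_injective (hinj (by simpa using h))) (by simpa using hKn)
  have hHA : H ⊆ topK K p := fun i hi =>
    mem_topK_comp (f := Sum.elim p q) Sum.inl_injective (Finset.mem_filter.1 hi).2
  have hGB : G ⊆ topK K q := fun j hj =>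
    mem_topK_comp (f := Sum.elim p q) Sum.inr_injective (Finset.mem_filter.1 hj).2
  have hsum : H.card + G.card = K := by
    have hTcard : T.card = K := card_topK hinj (by simp; omega)
    have hTeq : T = H.disjSum G := by
      ext x
      cases x <;> simp [hH, hG]
    rw [← Finset.card_disjSum, ← hTeq, hTcard]
  refine ⟨by omega, ?_⟩
  have hdiff : (topK K p \ H).card = K - H.card := by
    rw [Finset.card_sdiff_of_subset hHA, hA]
  have hbad : ((topK K p \ H) ×ˢ G).card = (K - hitNum np nn K p q) ^ 2 := by
    rw [Finset.card_product, hdiff, hhit, sq, show G.card = K - H.card by omega]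
  have hdisj : Disjoint ((topK K p ×ˢ topK K q).filter fun ij => q ij.2 < p ij.1)
      ((topK K p \ H) ×ˢ G) := by
    refine Finset.disjoint_left.2 fun ij h₁ h₂ => ?_
    have hlt := (Finset.mem_filter.1 h₁).2
    obtain ⟨hi, hj⟩ := Finset.mem_product.1 h₂
    refine (Finset.mem_sdiff.1 hi).2 (Finset.mem_filter.2 ⟨Finset.mem_univ _, ?_⟩)
    exact mem_topK_of_le (Finset.mem_filter.1 hj).2 hlt.le
  rw [← hbad, ← Finset.card_union_of_disjoint hdisj]
  calc _ ≤ (topK K p ×ˢ topK K q).card := Finset.card_le_card <| Finset.union_subset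
        (Finset.filter_subset _ _) (Finset.product_subset_product Finset.sdiff_subset hGB)
    _ = K ^ 2 := by rw [Finset.card_product, hA, hB, sq]

/-- with pairwise distinct scores and `K < n⁺`, `K < n⁻`,
`Precision@K ≥ (1/K)·⌊K − √(K² − n⁺·n⁻·LLPAUC(K/n⁺, K/n⁻))⌋`. -/
theorem precision_ge_llpauc_floor_bound (np nn K : ℕ) (p : Fin np → ℝ) (q : Fin nn → ℝ)
    (hinj : Function.Injective (Sum.elim p q)) (hKp : K < np) (hKn : K < nn) :
    (1 / (K : ℝ)) *
        ((⌊(K : ℝ) - Real.sqrt ((K : ℝ) ^ 2 - (np : ℝ) * (nn : ℝ) * llpauc np nn K p q)⌋ : ℤ) : ℝ)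
      ≤ precisionK np nn K p q := by
  obtain ⟨hle, hpairs⟩ := card_ordered_pairs_add_sq_le hinj hKp.le hKn.le
  have hnp : (np : ℝ) ≠ 0 := Nat.cast_ne_zero.2 (Nat.ne_zero_of_lt hKp)
  have hnn : (nn : ℝ) ≠ 0 := Nat.cast_ne_zero.2 (Nat.ne_zero_of_lt hKn)
  rw [precisionK, one_div, inv_mul_eq_div, llpauc, mul_div_cancel₀ _ (mul_ne_zero hnp hnn)]
  refine div_le_div_of_nonneg_right ((Int.floor_le _).trans ?_) (Nat.cast_nonneg K)
  rw [sub_le_comm]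
  refine Real.le_sqrt_of_sq_le ?_
  have hcast := (Nat.cast_le (α := ℝ)).2 hpairs
  push_cast [Nat.cast_sub hle] at hcast
  linarith
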